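/- Consider a 3×3 commutative diagram of vector spaces with objects A,B,C / D,E,F / G,H,I (rows) in which all four component squares are middle exact. Then the map f_{EI} : E → I induces an isomorphism E / (Im f_{DE} + Im f_{BE}) ≅ (Im f_{EI} + Im f_{CI}) / (Im f_{DI} + Im f_{CI}), where f_{CI} = f_{FI} ∘ f_{CF}, f_{DI} = f_{EI} ∘ f_{DE} (equivalently f_{HI} ∘ f_{DH}), etc. -/

import Mathlib

/-- If `M ≤ N`, then `f` induces an isomorphism
`E / f⁻¹(N) ≅ (range f ⊔ M) / (N ⊓ (range f ⊔ M))`. -/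
theorem exists_quotientEquiv_of_comap_eq {K E I : Type*} [Ring K]
    [AddCommGroup E] [Module K E] [AddCommGroup I] [Module K I]
    (f : E →ₗ[K] I) {P : Submodule K E} {M N : Submodule K I} (hMN : M ≤ N)
    (hP : N.comap f = P) :
    ∃ e : (E ⧸ P) ≃ₗ[K] ((LinearMap.range f ⊔ M : Submodule K I) ⧸
        N.comap (LinearMap.range f ⊔ M).subtype),
      ∀ x : E, e (Submodule.Quotient.mk x) =
        Submodule.Quotient.mk ⟨f x, Submodule.mem_sup_left (LinearMap.mem_range_self _ x)⟩ := by
  subst hP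
  let φ := (N.comap (LinearMap.range f ⊔ M).subtype).mkQ ∘ₗ
    f.codRestrict (LinearMap.range f ⊔ M)
      fun x => Submodule.mem_sup_left (LinearMap.mem_range_self f x)
  have hker : N.comap f = LinearMap.ker φ := by
    ext x
    simp [φ, LinearMap.mem_ker]
  have hsurj : Function.Surjective φ := by
    intro q
    obtain ⟨⟨y, hy⟩, rfl⟩ := Submodule.Quotient.mk_surjective _ q
    obtain ⟨_, ⟨x, rfl⟩, m, hm, rfl⟩ := Submodule.mem_sup.1 hy
    refine ⟨x, (Submodule.Quotient.eq _).2 ?_⟩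
    simpa using hMN hm
  exact ⟨(Submodule.quotEquivOfEq _ _ hker).trans (φ.quotKerEquivOfSurjective hsurj),
    fun _ => rfl⟩


/-- In a 3×3 diagram of vector spaces all of whose four component
squares are middle exact, the map `f_{EI}` induces an isomorphism
`E / (Im f_{DE} + Im f_{BE}) ≅ (Im f_{EI} + Im f_{CI}) / (Im f_{DI} + Im f_{CI})`. -/
theorem stmt2 {K A B C D E F G H I : Type*} [Field K]
    [AddCommGroup A] [Module K A] [AddCommGroup B] [Module K B]
    [AddCommGroup C] [Module K C] [AddCommGroup D] [Module K D]
    [AddCommGroup E] [Module K E] [AddCommGroup F] [Module K F]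
    [AddCommGroup G] [Module K G] [AddCommGroup H] [Module K H]
    [AddCommGroup I] [Module K I]
    (fAB : A →ₗ[K] B) (fBC : B →ₗ[K] C)
    (fDE : D →ₗ[K] E) (fEF : E →ₗ[K] F)
    (fGH : G →ₗ[K] H) (fHI : H →ₗ[K] I)
    (fAD : A →ₗ[K] D) (fDG : D →ₗ[K] G)
    (fBE : B →ₗ[K] E) (fEH : E →ₗ[K] H)
    (fCF : C →ₗ[K] F) (fFI : F →ₗ[K] I)
    -- the four component squares are commutative and middle exact
    (h₁ : ∀ (b : B) (d : D), fBE b = fDE d ↔ ∃ a, fAB a = b ∧ fAD a = d)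
    (h₂ : ∀ (c : C) (e : E), fCF c = fEF e ↔ ∃ b, fBC b = c ∧ fBE b = e)
    (h₃ : ∀ (e : E) (g : G), fEH e = fGH g ↔ ∃ d, fDE d = e ∧ fDG d = g)
    (h₄ : ∀ (x : F) (h : H), fFI x = fHI h ↔ ∃ e, fEF e = x ∧ fEH e = h) :
    ∃ e : (E ⧸ (LinearMap.range fDE ⊔ LinearMap.range fBE)) ≃ₗ[K]
        ((LinearMap.range (fFI ∘ₗ fEF) ⊔ LinearMap.range (fFI ∘ₗ fCF) :
            Submodule K I) ⧸
          Submodule.comap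
            (LinearMap.range (fFI ∘ₗ fEF) ⊔ LinearMap.range (fFI ∘ₗ fCF)).subtype
            (LinearMap.range ((fFI ∘ₗ fEF) ∘ₗ fDE) ⊔ LinearMap.range (fFI ∘ₗ fCF))),
      ∀ x : E, e (Submodule.Quotient.mk x) =
        Submodule.Quotient.mk
          ⟨(fFI ∘ₗ fEF) x,
            Submodule.mem_sup_left (LinearMap.mem_range_self _ x)⟩ := by
  refine exists_quotientEquiv_of_comap_eq (fFI ∘ₗ fEF) le_sup_right (le_antisymm ?_ ?_)
  · intro x hx
    obtain ⟨_, ⟨d, rfl⟩, _, ⟨c, rfl⟩, hdc⟩ := Submodule.mem_sup.1 (Submodule.mem_comap.1 hx)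
    simp only [LinearMap.comp_apply] at hdc
    obtain ⟨e, heF, heH⟩ := (h₄ (fEF (x - fDE d) - fCF c) 0).1 (by simp [← hdc])
    obtain ⟨d', rfl, -⟩ := (h₃ e 0).1 (by simp [heH])
    obtain ⟨b, -, hb⟩ := (h₂ c (x - fDE d - fDE d')).1 (by rw [map_sub, heF]; abel)
    refine Submodule.mem_sup.2 ⟨fDE (d + d'), ⟨_, rfl⟩, fBE b, ⟨_, rfl⟩, ?_⟩
    rw [hb, map_add]
    abel
  · refine sup_le ?_ ?_
    · rintro _ ⟨d, rfl⟩
      exact Submodule.mem_sup_left ⟨d, rfl⟩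
    · rintro _ ⟨b, rfl⟩
      have hb : fCF (fBC b) = fEF (fBE b) := (h₂ _ _).2 ⟨b, rfl, rfl⟩
      exact Submodule.mem_sup_right ⟨fBC b, congrArg fFI hb⟩
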